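/- arXiv:2601.06605 — 5 statements merged into one kernel-verified Lean document; each statement's English description precedes it below -/
import Mathlib

section
/- Let s ∈ ℝⁿ be a logit vector and α = Softmax(s) the probability vector with α_j = exp(s_j)/∑_{k=1}^n exp(s_k). Let s̃ ∈ ℝⁿ satisfy ‖s̃ − s‖_∞ ≤ δ for some δ ≥ 0 and set α̃ = Softmax(s̃). Then the total variation distance satisfies (1/2)·‖α̃ − α‖₁ ≤ 1 − e^{−2δ}. -/
/-- The softmax of a logit vector `s : Fin n → ℝ`:
`softmax s j = exp (s j) / ∑ k, exp (s k)`. -/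
noncomputable def softmax {n : ℕ} (s : Fin n → ℝ) : Fin n → ℝ :=
  fun j => Real.exp (s j) / ∑ k, Real.exp (s k)

theorem softmax_lower {n : ℕ} (s s' : Fin n → ℝ) (δ : ℝ)
    (hs : ∀ j, |s' j - s j| ≤ δ) (j : Fin n) :
    Real.exp (-2 * δ) * softmax s j ≤ softmax s' j := by
  have hZ : 0 < ∑ k, Real.exp (s k) :=
    Finset.sum_pos (fun _ _ => Real.exp_pos _) ⟨j, Finset.mem_univ j⟩
  have hZ' : 0 < ∑ k, Real.exp (s' k) :=
    Finset.sum_pos (fun _ _ => Real.exp_pos _) ⟨j, Finset.mem_univ j⟩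
  unfold softmax
  rw [← mul_div_assoc, div_le_div_iff₀ hZ hZ', Finset.mul_sum, Finset.mul_sum]
  apply Finset.sum_le_sum
  intro k _
  rw [← Real.exp_add, ← Real.exp_add, ← Real.exp_add]
  apply Real.exp_le_exp.mpr
  have h1 := abs_le.mp (hs j)
  have h2 := abs_le.mp (hs k)
  linarith [h1.1, h2.2]

theorem softmax_sum {n : ℕ} (s : Fin n → ℝ) (j : Fin n) : ∑ k, softmax s k = 1 := by
  have hZ : 0 < ∑ k, Real.exp (s k) :=
    Finset.sum_pos (fun _ _ => Real.exp_pos _) ⟨j, Finset.mem_univ j⟩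
  unfold softmax
  rw [← Finset.sum_div, div_self hZ.ne']

/-- If `‖s̃ − s‖_∞ ≤ δ` with `δ ≥ 0`, then the total variation distance between
`Softmax(s̃)` and `Softmax(s)` is at most `1 − e^{−2δ}`. -/
theorem softmax_total_variation_bound {n : ℕ} (s s' : Fin n → ℝ) (δ : ℝ)
    (hδ : 0 ≤ δ) (hs : ∀ j, |s' j - s j| ≤ δ) :
    (1 / 2) * ∑ j, |softmax s' j - softmax s j| ≤ 1 - Real.exp (-2 * δ) := by
  have hc : Real.exp (-2 * δ) ≤ 1 := Real.exp_le_one_iff.mpr (by linarith)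
  rcases Nat.eq_zero_or_pos n with h0 | hn
  · subst h0
    simpa using hc
  · have hb : ∀ j ∈ Finset.univ, |softmax s' j - softmax s j|
        ≤ softmax s' j + softmax s j - 2 * (Real.exp (-2 * δ) * softmax s j) := by
      intro j _
      have h1 := softmax_lower s s' δ hs j
      have hp : 0 ≤ softmax s j := by unfold softmax; positivity
      have h3 : Real.exp (-2 * δ) * softmax s j ≤ softmax s j :=
        mul_le_of_le_one_left hp hc
      rw [abs_le]
      constructor <;> linarith
    have h := Finset.sum_le_sum hb
    rw [Finset.sum_sub_distrib, Finset.sum_add_distrib, ← Finset.mul_sum, ← Finset.mul_sum,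
      softmax_sum s ⟨0, hn⟩, softmax_sum s' ⟨0, hn⟩] at h
    linarith
end

section
/- Let s ∈ ℝⁿ be a logit vector and α = Softmax(s). Let s̃ ∈ ℝⁿ satisfy ‖s̃ − s‖_∞ ≤ δ for some δ ≥ 0 and set α̃ = Softmax(s̃). Then ‖α̃ − α‖₁ ≤ 2(1 − e^{−2δ}). -/
/-- If `‖s̃ − s‖_∞ ≤ δ` with `δ ≥ 0`, then
`‖Softmax(s̃) − Softmax(s)‖₁ ≤ 2(1 − e^{−2δ})`. -/
theorem softmax_l1_perturbation_bound {n : ℕ} (s s' : Fin n → ℝ) (δ : ℝ)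
    (hδ : 0 ≤ δ) (hs : ∀ j, |s' j - s j| ≤ δ) :
    ∑ j, |softmax s' j - softmax s j| ≤ 2 * (1 - Real.exp (-2 * δ)) := by
  rcases Nat.eq_zero_or_pos n with h0 | hn
  · subst h0
    have : Real.exp (-2 * δ) ≤ 1 := Real.exp_le_one_iff.mpr (by linarith)
    simp only [Finset.univ_eq_empty, Finset.sum_empty]
    linarith
  haveI : Nonempty (Fin n) := ⟨⟨0, hn⟩⟩
  have hpos : ∀ t : Fin n → ℝ, 0 < ∑ k, Real.exp (t k) := fun t =>
    Finset.sum_pos (fun k _ => Real.exp_pos _) Finset.univ_nonempty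
  have hsum : ∀ t : Fin n → ℝ, ∑ j, softmax t j = 1 := fun t => by
    simp only [softmax]
    rw [← Finset.sum_div, div_self (hpos t).ne']
  have hc1 : Real.exp (-2 * δ) ≤ 1 := Real.exp_le_one_iff.mpr (by linarith)
  have hZ : ∑ k, Real.exp (s' k) ≤ Real.exp δ * ∑ k, Real.exp (s k) := by
    rw [Finset.mul_sum]
    refine Finset.sum_le_sum fun k _ => ?_
    rw [← Real.exp_add]
    exact Real.exp_le_exp.mpr (by linarith [(abs_le.mp (hs k)).2])
  have hlow : ∀ j, Real.exp (-2 * δ) * softmax s j ≤ softmax s' j := fun j => by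
    simp only [softmax]
    rw [← mul_div_assoc, div_le_div_iff₀ (hpos s) (hpos s')]
    calc Real.exp (-2 * δ) * Real.exp (s j) * ∑ k, Real.exp (s' k)
        ≤ Real.exp (-2 * δ) * Real.exp (s j) * (Real.exp δ * ∑ k, Real.exp (s k)) := by gcongr
      _ = Real.exp (-2 * δ + s j + δ) * ∑ k, Real.exp (s k) := by
          rw [Real.exp_add, Real.exp_add]; ring
      _ ≤ Real.exp (s' j) * ∑ k, Real.exp (s k) := by
          refine mul_le_mul_of_nonneg_right (Real.exp_le_exp.mpr ?_) (hpos s).le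
          linarith [(abs_le.mp (hs j)).1]
  have hnn : ∀ j, 0 ≤ softmax s j := fun j => div_nonneg (Real.exp_pos _).le (hpos s).le
  calc ∑ j, |softmax s' j - softmax s j|
      ≤ ∑ j, (softmax s' j + softmax s j - 2 * Real.exp (-2 * δ) * softmax s j) := by
        refine Finset.sum_le_sum fun j _ => ?_
        have h1 := hlow j
        have h2 := mul_le_mul_of_nonneg_right hc1 (hnn j)
        rw [abs_le]
        constructor <;> linarith
    _ = 2 * (1 - Real.exp (-2 * δ)) := by
        rw [Finset.sum_sub_distrib, Finset.sum_add_distrib, ← Finset.mul_sum, hsum, hsum]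
        ring
end

section
/- Let s ∈ ℝⁿ be a logit vector and α = Softmax(s). Let s̃ ∈ ℝⁿ satisfy ‖s̃ − s‖_∞ ≤ δ for some δ ≥ 0 and set α̃ = Softmax(s̃). Then ‖α̃ − α‖₁ ≤ 4δ; in particular the bound 2(1 − e^{−2δ}) behaves as 4δ + O(δ²) for small δ. -/
/-- If `‖s̃ − s‖_∞ ≤ δ` with `δ ≥ 0`, then `‖Softmax(s̃) − Softmax(s)‖₁ ≤ 4δ`;
moreover the bound `2(1 − e^{−2δ})` behaves as `4δ + O(δ²)` for small `δ`. -/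
theorem softmax_l1_linear_bound {n : ℕ} (s s' : Fin n → ℝ) (δ : ℝ)
    (hδ : 0 ≤ δ) (hs : ∀ j, |s' j - s j| ≤ δ) :
    (∑ j, |softmax s' j - softmax s j| ≤ 4 * δ) ∧
      (fun d : ℝ => 2 * (1 - Real.exp (-2 * d)) - 4 * d) =O[nhds 0]
        (fun d : ℝ => d ^ 2) := by
  constructor
  · rcases Nat.eq_zero_or_pos n with h0 | hn
    · subst h0
      simpa using hδ
    have : Nonempty (Fin n) := ⟨⟨0, hn⟩⟩
    have hZ : ∀ u : Fin n → ℝ, 0 < ∑ k, Real.exp (u k) := fun u =>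
      Finset.sum_pos (fun i _ => Real.exp_pos _) Finset.univ_nonempty
    have hsum : ∀ u : Fin n → ℝ, ∑ j, softmax u j = 1 := by
      intro u
      unfold softmax
      rw [← Finset.sum_div]
      exact div_self (hZ u).ne'
    have hpos : ∀ (u : Fin n → ℝ) j, 0 ≤ softmax u j := fun u j =>
      div_nonneg (Real.exp_pos _).le (hZ u).le
    have hZle : ∑ k, Real.exp (s' k) ≤ Real.exp δ * ∑ k, Real.exp (s k) := by
      rw [Finset.mul_sum]
      refine Finset.sum_le_sum fun k _ => ?_
      rw [← Real.exp_add]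
      have := (abs_le.mp (hs k)).2
      exact Real.exp_le_exp.mpr (by linarith)
    have hc : ∀ j, Real.exp (-2 * δ) * softmax s j ≤ softmax s' j := by
      intro j
      unfold softmax
      rw [← mul_div_assoc, div_le_div_iff₀ (hZ s) (hZ s')]
      have h1 : Real.exp (-2 * δ) * Real.exp (s j) * Real.exp δ ≤ Real.exp (s' j) := by
        rw [← Real.exp_add, ← Real.exp_add]
        have := (abs_le.mp (hs j)).1
        exact Real.exp_le_exp.mpr (by linarith)
      calc Real.exp (-2 * δ) * Real.exp (s j) * ∑ k, Real.exp (s' k)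
          ≤ Real.exp (-2 * δ) * Real.exp (s j) * (Real.exp δ * ∑ k, Real.exp (s k)) :=
            mul_le_mul_of_nonneg_left hZle (by positivity)
        _ = Real.exp (-2 * δ) * Real.exp (s j) * Real.exp δ * ∑ k, Real.exp (s k) := by ring
        _ ≤ _ := mul_le_mul_of_nonneg_right h1 (hZ s).le
    have hc1 : Real.exp (-2 * δ) ≤ 1 := Real.exp_le_one_iff.mpr (by linarith)
    calc ∑ j, |softmax s' j - softmax s j|
        ≤ ∑ j, (softmax s' j + softmax s j - 2 * Real.exp (-2 * δ) * softmax s j) := by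
          refine Finset.sum_le_sum fun j _ => abs_le.mpr ⟨?_, ?_⟩
          · linarith [hc j]
          · linarith [mul_le_mul_of_nonneg_right hc1 (hpos s j)]
      _ = 2 - 2 * Real.exp (-2 * δ) := by
          rw [Finset.sum_sub_distrib, Finset.sum_add_distrib, ← Finset.mul_sum, hsum, hsum]
          ring
      _ ≤ 4 * δ := by linarith [Real.add_one_le_exp (-2 * δ)]
  · refine Asymptotics.IsBigO.of_bound 8 ?_
    filter_upwards [Metric.ball_mem_nhds (0 : ℝ) (by norm_num : (0 : ℝ) < 1 / 2)] with d hd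
    rw [mem_ball_zero_iff, Real.norm_eq_abs] at hd
    have h := Real.abs_exp_sub_one_sub_id_le (x := -2 * d) (by
      rw [abs_mul]; norm_num; linarith)
    rw [Real.norm_eq_abs, Real.norm_eq_abs, abs_of_nonneg (sq_nonneg d)]
    rw [abs_le] at h ⊢
    constructor <;> nlinarith [h.1, h.2]
end

section
/- Let Z ∈ ℝ^{m×n} be a matrix of attention logits with row-wise softmax α (each row i has α_{i,j} = exp(Z_{i,j})/∑_k exp(Z_{i,k})), and let S_p, S_s ⊆ {1,…,n} be disjoint nonempty column blocks. Define λ_p = log ∑_{i=1}^m ∑_{j∈S_p} α_{i,j}, λ_s = log ∑_{i=1}^m ∑_{j∈S_s} α_{i,j}, and λ = λ_p/(λ_p + λ_s). Let Z̃ be a perturbed logit matrix with |Z̃_{i,j} − Z_{i,j}| ≤ δ for all i, j, with row-wise softmax α̃ and corresponding λ̃_p, λ̃_s, λ̃ = λ̃_p/(λ̃_p + λ̃_s). If λ_p > 0, λ_s > 0, and λ̃_p + λ̃_s ≥ λ_p + λ_s, then |λ̃ − λ| ≤ 2δ/(λ_p + λ_s). -/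
/-- Row-wise softmax of a logit matrix `Z : Fin m → Fin n → ℝ`:
`rowSoftmax Z i j = exp (Z i j) / ∑ k, exp (Z i k)`. -/
noncomputable def rowSoftmax {m n : ℕ} (Z : Fin m → Fin n → ℝ) : Fin m → Fin n → ℝ :=
  fun i j => Real.exp (Z i j) / ∑ k, Real.exp (Z i k)

/-- The alignment strength of the key block `S`: the logarithm of the total
row-softmax probability mass on `S`, summed over all query rows. -/
noncomputable def alignStrength {m n : ℕ} (Z : Fin m → Fin n → ℝ)
    (S : Finset (Fin n)) : ℝ :=
  Real.log (∑ i, ∑ j ∈ S, rowSoftmax Z i j)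

theorem softmax_perturb {m n : ℕ} (Z Z' : Fin m → Fin n → ℝ) (δ : ℝ)
    (hZ : ∀ i j, |Z' i j - Z i j| ≤ δ) (i : Fin m) (j : Fin n) :
    rowSoftmax Z' i j ≤ Real.exp (2 * δ) * rowSoftmax Z i j := by
  unfold rowSoftmax
  have hpos : ∀ W : Fin m → Fin n → ℝ, 0 < ∑ k, Real.exp (W i k) := fun W =>
    Finset.sum_pos (fun k _ => Real.exp_pos _) ⟨j, Finset.mem_univ j⟩
  have h1 : Real.exp (Z' i j) ≤ Real.exp δ * Real.exp (Z i j) := by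
    rw [← Real.exp_add, Real.exp_le_exp]
    have := abs_le.1 (hZ i j)
    linarith [this.2]
  have h2 : ∑ k, Real.exp (Z i k) ≤ Real.exp δ * ∑ k, Real.exp (Z' i k) := by
    rw [Finset.mul_sum]
    refine Finset.sum_le_sum fun k _ => ?_
    rw [← Real.exp_add, Real.exp_le_exp]
    have := abs_le.1 (hZ i k)
    linarith [this.1]
  have h3 : Real.exp (2 * δ) = Real.exp δ * Real.exp δ := by
    rw [← Real.exp_add]; ring_nf
  rw [← mul_div_assoc, div_le_div_iff₀ (hpos Z') (hpos Z), h3]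
  calc _ ≤ (Real.exp δ * Real.exp (Z i j)) * (Real.exp δ * ∑ k, Real.exp (Z' i k)) :=
        mul_le_mul h1 h2 (hpos Z).le (by positivity)
    _ = _ := by ring

theorem mass_pos {m n : ℕ} (Z : Fin m → Fin n → ℝ) (S : Finset (Fin n))
    (hS : S.Nonempty) (i : Fin m) : 0 < ∑ i, ∑ j ∈ S, rowSoftmax Z i j := by
  refine Finset.sum_pos (fun i _ => Finset.sum_pos (fun j _ => ?_) hS) ⟨i, Finset.mem_univ i⟩
  exact div_pos (Real.exp_pos _)
    (Finset.sum_pos (fun k _ => Real.exp_pos _) ⟨j, Finset.mem_univ j⟩)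

theorem align_perturb {m n : ℕ} (Z Z' : Fin m → Fin n → ℝ) (δ : ℝ)
    (hZ : ∀ i j, |Z' i j - Z i j| ≤ δ) (S : Finset (Fin n)) (hS : S.Nonempty) (i : Fin m) :
    alignStrength Z' S ≤ alignStrength Z S + 2 * δ := by
  unfold alignStrength
  have h : ∑ i, ∑ j ∈ S, rowSoftmax Z' i j
      ≤ Real.exp (2 * δ) * ∑ i, ∑ j ∈ S, rowSoftmax Z i j := by
    rw [Finset.mul_sum]
    refine Finset.sum_le_sum fun i _ => ?_
    rw [Finset.mul_sum]
    exact Finset.sum_le_sum fun j _ => softmax_perturb Z Z' δ hZ i j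
  have := Real.log_le_log (mass_pos Z' S hS i) h
  rw [Real.log_mul (Real.exp_pos _).ne' (mass_pos Z S hS i).ne', Real.log_exp] at this
  linarith

/-- Stability of the dynamic scaling coefficient `λ = λ_p/(λ_p + λ_s)` under an
`ℓ∞` perturbation of the attention logits of size at most `δ`: if `λ_p > 0`,
`λ_s > 0` and `λ̃_p + λ̃_s ≥ λ_p + λ_s`, then `|λ̃ − λ| ≤ 2δ/(λ_p + λ_s)`. -/
theorem dssi_lambda_perturbation_bound {m n : ℕ} (Z Z' : Fin m → Fin n → ℝ) (δ : ℝ)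
    (Sp Ss : Finset (Fin n)) (hdisj : Disjoint Sp Ss)
    (hSp : Sp.Nonempty) (hSs : Ss.Nonempty)
    (hZ : ∀ i j, |Z' i j - Z i j| ≤ δ)
    (hp : 0 < alignStrength Z Sp) (hs : 0 < alignStrength Z Ss)
    (hsum : alignStrength Z Sp + alignStrength Z Ss
      ≤ alignStrength Z' Sp + alignStrength Z' Ss) :
    |alignStrength Z' Sp / (alignStrength Z' Sp + alignStrength Z' Ss)
        - alignStrength Z Sp / (alignStrength Z Sp + alignStrength Z Ss)|
      ≤ 2 * δ / (alignStrength Z Sp + alignStrength Z Ss) := by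
  have hm : Nonempty (Fin m) := by
    by_contra hne
    rw [not_nonempty_iff] at hne
    simp [alignStrength] at hp
  obtain ⟨i⟩ := hm
  obtain ⟨j, _⟩ := hSp.exists_mem
  have hδ : 0 ≤ δ := (abs_nonneg _).trans (hZ i j)
  have hZ2 : ∀ i j, |Z i j - Z' i j| ≤ δ := fun i j => by
    rw [abs_sub_comm]; exact hZ i j
  have p1 := align_perturb Z Z' δ hZ Sp hSp i
  have p2 := align_perturb Z' Z δ hZ2 Sp hSp i
  have s1 := align_perturb Z Z' δ hZ Ss hSs i
  have s2 := align_perturb Z' Z δ hZ2 Ss hSs i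
  generalize alignStrength Z Sp = a at *
  generalize alignStrength Z Ss = b at *
  generalize alignStrength Z' Sp = c at *
  generalize alignStrength Z' Ss = d at *
  have hs0 : 0 < a + b := by linarith
  have hs1 : 0 < c + d := by linarith
  have key : |c / (c + d) - a / (a + b)| ≤ 2 * δ / (c + d) := by
    have e : c / (c + d) - a / (a + b) = ((c - a) * b - a * (d - b)) / ((c + d) * (a + b)) := by
      field_simp
      ring
    have e2 : 2 * δ / (c + d) = (2 * δ * (a + b)) / ((c + d) * (a + b)) := by
      field_simp
    rw [e, e2, abs_div, abs_of_pos (mul_pos hs1 hs0)]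
    refine div_le_div_of_nonneg_right ?_ (mul_pos hs1 hs0).le
    rw [abs_le]
    constructor <;> nlinarith
  exact key.trans (div_le_div_of_nonneg_left (by linarith) hs0 hsum)
end

section
/- Under the hypotheses of the DSSI decomposition, suppose additionally that ‖α̃_* − α_*‖₁ ≤ 2(1 − e^{−2δ}) for each branch * ∈ {p, s, o}, that the perturbed attention weights satisfy ‖α̃_p‖₁ ≤ 1 and ‖α̃_s‖₁ ≤ 1, and that |λ̃ − λ| ≤ 2δ/(λ_p + λ_s) with λ_p + λ_s > 0. Then ‖h̃_o − h_o‖ ≤ 2(1 − e^{−2δ})·((1 − λ)·M_p + λ·M_s + M_o) + (2δ/(λ_p + λ_s))·(M_p + M_s); in particular, since λ ∈ [0, 1], the first summand is at most the vanilla-setting bound 2(1 − e^{−2δ})·(M_p + M_s + M_o). -/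
theorem dssi_aux_bound {E : Type*} [NormedAddCommGroup E] [NormedSpace ℝ E] {n : ℕ}
    (V : Fin n → E) (M c : ℝ) (hM : 0 ≤ M) (hV : ∀ i, ‖V i‖ ≤ M) (a : Fin n → ℝ)
    (ha : ∑ i, |a i| ≤ c) : ‖∑ i, a i • V i‖ ≤ c * M := by
  calc ‖∑ i, a i • V i‖ ≤ ∑ i, ‖a i • V i‖ := norm_sum_le _ _
    _ ≤ ∑ i, |a i| * M := by
        apply Finset.sum_le_sum
        intro i _
        rw [norm_smul, Real.norm_eq_abs]
        exact mul_le_mul_of_nonneg_left (hV i) (abs_nonneg _)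
    _ = (∑ i, |a i|) * M := by rw [Finset.sum_mul]
    _ ≤ c * M := mul_le_mul_of_nonneg_right ha hM

/-- Final DSSI noise-sensitivity bound: with `λ = λ_p/(λ_p + λ_s)` for positive
alignment strengths, `ℓ¹` attention-weight perturbations bounded by
`2(1 − e^{−2δ})`, perturbed weights of `ℓ¹` norm at most `1`, and
`|λ̃ − λ| ≤ 2δ/(λ_p + λ_s)`, the DSSI outputs satisfy
`‖h̃_o − h_o‖ ≤ 2(1 − e^{−2δ})·((1 − λ)M_p + λM_s + M_o)
 + (2δ/(λ_p + λ_s))·(M_p + M_s)`; moreover, since `λ ∈ [0,1]`, the first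
summand is at most the vanilla bound `2(1 − e^{−2δ})·(M_p + M_s + M_o)`. -/
theorem dssi_final_noise_bound {E : Type*} [NormedAddCommGroup E]
    [NormedSpace ℝ E] {np ns no : ℕ}
    (Vp : Fin np → E) (Vs : Fin ns → E) (Vo : Fin no → E)
    (Mp Ms Mo δ lp ls : ℝ) (hδ : 0 ≤ δ)
    (hMp : 0 ≤ Mp) (hMs : 0 ≤ Ms) (hMo : 0 ≤ Mo)
    (hlp : 0 < lp) (hls : 0 < ls)
    (hVp : ∀ i, ‖Vp i‖ ≤ Mp) (hVs : ∀ i, ‖Vs i‖ ≤ Ms) (hVo : ∀ i, ‖Vo i‖ ≤ Mo)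
    (lam lam' : ℝ) (hlam : lam = lp / (lp + ls))
    (hlam' : lam' ∈ Set.Icc (0 : ℝ) 1)
    (ap ap' : Fin np → ℝ) (as as' : Fin ns → ℝ) (ao ao' : Fin no → ℝ)
    (hp : ∑ i, |ap' i - ap i| ≤ 2 * (1 - Real.exp (-2 * δ)))
    (hs : ∑ i, |as' i - as i| ≤ 2 * (1 - Real.exp (-2 * δ)))
    (ho : ∑ i, |ao' i - ao i| ≤ 2 * (1 - Real.exp (-2 * δ)))
    (hap' : ∑ i, |ap' i| ≤ 1) (has' : ∑ i, |as' i| ≤ 1)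
    (hlamdiff : |lam' - lam| ≤ 2 * δ / (lp + ls)) :
    ‖((1 - lam') • (∑ i, ap' i • Vp i) + lam' • (∑ i, as' i • Vs i)
          + (∑ i, ao' i • Vo i))
        - ((1 - lam) • (∑ i, ap i • Vp i) + lam • (∑ i, as i • Vs i)
          + (∑ i, ao i • Vo i))‖
      ≤ 2 * (1 - Real.exp (-2 * δ)) * ((1 - lam) * Mp + lam * Ms + Mo)
        + (2 * δ / (lp + ls)) * (Mp + Ms) ∧
    2 * (1 - Real.exp (-2 * δ)) * ((1 - lam) * Mp + lam * Ms + Mo)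
      ≤ 2 * (1 - Real.exp (-2 * δ)) * (Mp + Ms + Mo) := by
  have hl0 : 0 ≤ lam := by rw [hlam]; positivity
  have hl1 : 0 ≤ 1 - lam := by
    rw [hlam, sub_nonneg, div_le_one (by positivity)]; linarith
  have hc : 0 ≤ 2 * (1 - Real.exp (-2 * δ)) := by
    have : Real.exp (-2 * δ) ≤ 1 := Real.exp_le_one_iff.mpr (by linarith)
    linarith
  have hp1 := dssi_aux_bound Vp Mp _ hMp hVp (fun i => ap' i - ap i) hp
  have hs1 := dssi_aux_bound Vs Ms _ hMs hVs (fun i => as' i - as i) hs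
  have ho1 := dssi_aux_bound Vo Mo _ hMo hVo (fun i => ao' i - ao i) ho
  have hp2 := dssi_aux_bound Vp Mp _ hMp hVp ap' hap'
  have hs2 := dssi_aux_bound Vs Ms _ hMs hVs as' has'
  simp only [sub_smul, Finset.sum_sub_distrib] at hp1 hs1 ho1
  generalize 2 * (1 - Real.exp (-2 * δ)) = c at *
  generalize 2 * δ / (lp + ls) = d at *
  generalize ∑ i, ap' i • Vp i = P' at *
  generalize ∑ i, ap i • Vp i = P at *
  generalize ∑ i, as' i • Vs i = S' at *
  generalize ∑ i, as i • Vs i = S at *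
  generalize ∑ i, ao' i • Vo i = O' at *
  generalize ∑ i, ao i • Vo i = O at *
  constructor
  · have key : ((1 - lam') • P' + lam' • S' + O') - ((1 - lam) • P + lam • S + O)
        = (1 - lam) • (P' - P) + lam • (S' - S) + (O' - O) + (lam' - lam) • (S' - P') := by
      module
    rw [key]
    have h1 : ‖(1 - lam) • (P' - P)‖ ≤ (1 - lam) * (c * Mp) := by
      rw [norm_smul, Real.norm_of_nonneg hl1]
      exact mul_le_mul_of_nonneg_left hp1 hl1
    have h2 : ‖lam • (S' - S)‖ ≤ lam * (c * Ms) := by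
      rw [norm_smul, Real.norm_of_nonneg hl0]
      exact mul_le_mul_of_nonneg_left hs1 hl0
    have h3 : ‖(lam' - lam) • (S' - P')‖ ≤ d * (Mp + Ms) := by
      rw [norm_smul, Real.norm_eq_abs]
      apply mul_le_mul hlamdiff _ (norm_nonneg _) ((abs_nonneg _).trans hlamdiff)
      have := norm_sub_le S' P'
      linarith
    have h4 := norm_add₄_le (a := (1 - lam) • (P' - P)) (b := lam • (S' - S))
      (c := O' - O) (d := (lam' - lam) • (S' - P'))
    linarith
  · apply mul_le_mul_of_nonneg_left _ hc
    nlinarith [mul_nonneg hl0 hMp, mul_nonneg hl1 hMs]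
end
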